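/- Let G be a finite abelian group. For every g ∈ G and every integer m ≥ D(G) − 1, there exists a sequence S over G of length m such that g ∈ Σ•(S) and N_g(S) = 2^{m−D(G)+1}. -/

import Mathlib

/-- `NSub S g` is the number of subsequences (sub-multisets, counted with the
multiplicity of their appearance in `S`) of the sequence `S` with sum `g`. -/
def NSub {G : Type*} [AddCommGroup G] [DecidableEq G] (S : Multiset G) (g : G) : ℕ :=
  (S.powerset.filter (fun T => T.sum = g)).card

/-- The Davenport constant of `G`: the smallest positive integer `ℓ` such that every
sequence over `G` of length at least `ℓ` has a nonempty zero-sum subsequence. -/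
noncomputable def Davenport (G : Type*) [AddCommGroup G] : ℕ :=
  sInf {ℓ : ℕ | 0 < ℓ ∧ ∀ S : Multiset G, ℓ ≤ Multiset.card S →
    ∃ T : Multiset G, T ≤ S ∧ T ≠ 0 ∧ T.sum = 0}

/-- `ESet S = {g ∈ G : N_g(S) = 2 ^ (|S| - D(G) + 1)}`. -/
def ESet {G : Type*} [AddCommGroup G] [DecidableEq G] (S : Multiset G) : Set G :=
  {g | NSub S g = 2 ^ (Multiset.card S + 1 - Davenport G)}

/-- A minimal zero-sum sequence: nonempty, zero-sum, and every nonempty proper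
subsequence has nonzero sum. -/
def IsMinZeroSum {G : Type*} [AddCommGroup G] (T : Multiset G) : Prop :=
  T ≠ 0 ∧ T.sum = 0 ∧ ∀ U : Multiset G, U ≤ T → U ≠ 0 → U ≠ T → U.sum ≠ 0

section NSub

variable {G : Type*} [AddCommGroup G] [DecidableEq G]

theorem NSub_cons (a : G) (S : Multiset G) (g : G) :
    NSub (a ::ₘ S) g = NSub S g + NSub S (g - a) := by
  simp only [NSub, Multiset.powerset_cons, Multiset.filter_add, Multiset.card_add,
    Multiset.filter_map, Multiset.card_map, Function.comp_def, Multiset.sum_cons,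
    eq_sub_iff_add_eq']

theorem NSub_pos_iff {S : Multiset G} {g : G} :
    0 < NSub S g ↔ ∃ T : Multiset G, T ≤ S ∧ T.sum = g := by
  simp [NSub, Multiset.card_pos_iff_exists_mem]

/-- Prepending `k` zeros multiplies every `NSub` by `2 ^ k`. -/
theorem NSub_replicate_zero_add (k : ℕ) (S : Multiset G) (g : G) :
    NSub (Multiset.replicate k 0 + S) g = 2 ^ k * NSub S g := by
  induction k with
  | zero => simp
  | succ k ih =>
    rw [Multiset.replicate_succ, Multiset.cons_add, NSub_cons, sub_zero, ih, pow_succ]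
    ring

/-- Negating the terms of `T` translates the argument of `NSub` by the sum of `T`. -/
theorem NSub_map_neg_add (T V : Multiset G) (g : G) :
    NSub (T.map (fun x => -x) + V) g = NSub (T + V) (g + T.sum) := by
  induction T using Multiset.induction_on generalizing g with
  | empty => simp
  | cons a T ih =>
    rw [Multiset.map_cons, Multiset.cons_add, Multiset.cons_add, NSub_cons, NSub_cons, ih, ih,
      Multiset.sum_cons, add_comm]
    congr 2 <;> abel

theorem NSub_zero_eq_one {U : Multiset G}
    (hU : ∀ T : Multiset G, T ≤ U → T ≠ 0 → T.sum ≠ 0) : NSub U 0 = 1 := by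
  induction U using Multiset.induction_on with
  | empty => simp [NSub, Multiset.filter_singleton]
  | cons a U ih =>
    have h : NSub U (0 - a) = 0 := by
      by_contra hne
      obtain ⟨T, hT, hs⟩ := NSub_pos_iff.1 (Nat.pos_of_ne_zero hne)
      exact hU (a ::ₘ T) ((Multiset.cons_le_cons_iff a).2 hT) (Multiset.cons_ne_zero)
        (by simp [hs])
    rw [NSub_cons, h, ih fun T hT => hU T (hT.trans (Multiset.le_cons_self U a))]

end NSub

section Davenport

variable {G : Type*} [AddCommGroup G] [Fintype G]

theorem exists_sum_eq_zero_of_card_mul_card_le {S : Multiset G}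
    (hS : Fintype.card G * Fintype.card G ≤ Multiset.card S) :
    ∃ T : Multiset G, T ≤ S ∧ T ≠ 0 ∧ T.sum = 0 := by
  classical
  obtain ⟨a, ha⟩ : ∃ a : G, Fintype.card G ≤ S.count a := by
    by_contra! h
    have hsum : ∑ a : G, S.count a = Multiset.card S :=
      Multiset.sum_count_eq_card fun a _ => Finset.mem_univ a
    have hlt : ∑ a : G, S.count a < ∑ _a : G, Fintype.card G :=
      Finset.sum_lt_sum_of_nonempty Finset.univ_nonempty fun a _ => h a
    simp only [Finset.sum_const, Finset.card_univ, smul_eq_mul] at hlt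
    omega
  refine ⟨Multiset.replicate (Fintype.card G) a, Multiset.le_count_iff_replicate_le.1 ha, ?_, ?_⟩
  · rw [← Multiset.card_pos, Multiset.card_replicate]
    exact Fintype.card_pos
  · rw [Multiset.sum_replicate, card_nsmul_eq_zero]

variable (G) in
theorem davenport_spec : 0 < Davenport G ∧ ∀ S : Multiset G, Davenport G ≤ Multiset.card S →
    ∃ T : Multiset G, T ≤ S ∧ T ≠ 0 ∧ T.sum = 0 :=
  Nat.sInf_mem (s := {ℓ : ℕ | 0 < ℓ ∧ ∀ S : Multiset G, ℓ ≤ Multiset.card S →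
    ∃ T : Multiset G, T ≤ S ∧ T ≠ 0 ∧ T.sum = 0})
    ⟨Fintype.card G * Fintype.card G, Nat.mul_pos Fintype.card_pos Fintype.card_pos,
      fun _ => exists_sum_eq_zero_of_card_mul_card_le⟩

variable (G) in
theorem exists_zeroSumFree_card_add_one_eq_davenport :
    ∃ U : Multiset G, Multiset.card U + 1 = Davenport G ∧
      ∀ T : Multiset G, T ≤ U → T ≠ 0 → T.sum ≠ 0 := by
  obtain ⟨hpos, hD⟩ := davenport_spec G
  rcases Nat.eq_or_lt_of_le (Nat.succ_le_of_lt hpos) with h1 | h1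
  · exact ⟨0, by simpa using h1, fun T hT hne => absurd (Multiset.le_zero.1 hT) hne⟩
  · have hmin : Davenport G - 1 ∉ {ℓ : ℕ | 0 < ℓ ∧ ∀ S : Multiset G, ℓ ≤ Multiset.card S →
        ∃ T : Multiset G, T ≤ S ∧ T ≠ 0 ∧ T.sum = 0} :=
      Nat.notMem_of_lt_sInf (Nat.sub_lt hpos one_pos)
    simp only [Set.mem_ofPred_eq, not_and] at hmin
    have hex := hmin (by omega)
    push Not at hex
    obtain ⟨U, hU, hfree⟩ := hex
    refine ⟨U, ?_, hfree⟩
    by_contra hne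
    obtain ⟨T, hT, hT0, hTs⟩ := hD U (by omega)
    exact hfree T hT hT0 hTs

/-- Every element is a subsequence sum of a zero-sum free sequence of maximal length. -/
theorem exists_le_sum_eq_of_zeroSumFree {U : Multiset G}
    (hcard : Davenport G ≤ Multiset.card U + 1)
    (hU : ∀ T : Multiset G, T ≤ U → T ≠ 0 → T.sum ≠ 0) (g : G) :
    ∃ T : Multiset G, T ≤ U ∧ T.sum = g := by
  obtain ⟨T, hT, hT0, hTs⟩ := (davenport_spec G).2 (-g ::ₘ U) (by simpa using hcard)
  by_cases hg : -g ∈ T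
  · obtain ⟨T', rfl⟩ := Multiset.exists_cons_of_mem hg
    refine ⟨T', (Multiset.cons_le_cons_iff _).1 hT, ?_⟩
    rw [Multiset.sum_cons, neg_add_eq_zero] at hTs
    exact hTs.symm
  · exact absurd hTs (hU T ((Multiset.le_cons_of_notMem hg).1 hT) hT0)

end Davenport

theorem stmt2 {G : Type*} [AddCommGroup G] [Fintype G] [DecidableEq G]
    (g : G) (m : ℕ) (hm : Davenport G - 1 ≤ m) :
    ∃ S : Multiset G, Multiset.card S = m ∧
      (∃ T : Multiset G, T ≤ S ∧ T.sum = g) ∧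
      NSub S g = 2 ^ (m + 1 - Davenport G) := by
  obtain ⟨U, hcard, hU⟩ := exists_zeroSumFree_card_add_one_eq_davenport G
  obtain ⟨T, hT, hTs⟩ := exists_le_sum_eq_of_zeroSumFree hcard.ge hU (-g)
  obtain ⟨V, rfl⟩ := Multiset.le_iff_exists_add.1 hT
  have hN : NSub (Multiset.replicate (m + 1 - Davenport G) 0 +
      (T.map (fun x => -x) + V)) g = 2 ^ (m + 1 - Davenport G) := by
    rw [NSub_replicate_zero_add, NSub_map_neg_add, hTs, add_neg_cancel, NSub_zero_eq_one hU,
      mul_one]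
  refine ⟨_, ?_, NSub_pos_iff.1 (hN ▸ Nat.two_pow_pos _), hN⟩
  simp only [Multiset.card_add, Multiset.card_replicate, Multiset.card_map] at hcard ⊢
  omega
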